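/- Let a ∈ {2, 3, 4, 5}, let ℓ ≥ 11 be prime, and let p be a prime with p ≡ −1 (mod ℓ). Then for every positive integer n not divisible by p, MO(a; pn) ≡ 0 (mod ℓ). -/

import Mathlib

open Finset

/-- `MO a n` is MacMahon's coefficient: the sum of the products `s_1 ⋯ s_a` over all
strictly increasing tuples `0 < k_1 < ⋯ < k_a` of positive integers and positive
integers `s_1, …, s_a` with `s_1*k_1 + ⋯ + s_a*k_a = n` (all such data satisfy
`k_i, s_i ≤ n`, so we may sum over a finite set); in particular `MO a 0 = 0` for `a ≥ 1`. -/
def MO (a n : ℕ) : ℕ :=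
  ∑ f ∈ Finset.univ.filter (fun f : Fin a → Fin (n + 1) × Fin (n + 1) =>
      (∀ i, 0 < ((f i).1 : ℕ) ∧ 0 < ((f i).2 : ℕ)) ∧
      (∀ i j : Fin a, i < j → (f i).1 < (f j).1) ∧
      (∑ i, ((f i).2 : ℕ) * ((f i).1 : ℕ)) = n),
    ∏ i, ((f i).2 : ℕ)

section Eisenstein

open UpperHalfPlane hiding I
open Complex Function Matrix.SpecialLinearGroup
open scoped Manifold MatrixGroups ModularForm Topology Real ArithmeticFunction.sigma

/-- `F` is a holomorphic function on the upper half plane with the `q`-expansion `φ`. -/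
structure HasQExp (F : ℍ → ℂ) (φ : PowerSeries ℂ) : Prop where
  mdiff : MDiff F
  hasSum : ∀ τ : ℍ, HasSum (fun m : ℕ ↦ φ.coeff m • Periodic.qParam 1 (τ : ℂ) ^ m) (F τ)

namespace HasQExp

variable {F G : ℍ → ℂ} {φ ψ : PowerSeries ℂ}

lemma add (hF : HasQExp F φ) (hG : HasQExp G ψ) : HasQExp (F + G) (φ + ψ) :=
  ⟨hF.mdiff.add hG.mdiff, fun τ ↦ by
    simpa [add_mul] using (hF.hasSum τ).add (hG.hasSum τ)⟩

lemma smul (c : ℂ) (hF : HasQExp F φ) : HasQExp (c • F) (c • φ) :=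
  ⟨hF.mdiff.const_smul c, fun τ ↦ by
    simpa [mul_assoc] using (hF.hasSum τ).mul_left c⟩

lemma mul (hF : HasQExp F φ) (hG : HasQExp G ψ) : HasQExp (F * G) (φ * ψ) := by
  refine ⟨hF.mdiff.mul hG.mdiff, fun τ ↦ ?_⟩
  have h := (hasSum_sum_range_mul_of_summable_norm (hF.hasSum τ).summable.norm
    (hG.hasSum τ).summable.norm)
  rw [(hF.hasSum τ).tsum_eq, (hG.hasSum τ).tsum_eq] at h
  convert! h using 1
  ext n
  rw [PowerSeries.coeff_mul, Finset.Nat.sum_antidiagonal_eq_sum_range_succ_mk, sum_smul]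
  refine sum_congr rfl fun k hk ↦ ?_
  rw [← Nat.add_sub_cancel' (mem_range_succ_iff.mp hk), pow_add]
  simp only [smul_eq_mul, Nat.add_sub_cancel_left]
  ring

lemma isBoundedAtImInfty (hF : HasQExp F φ) : IsBoundedAtImInfty F :=
  isBoundedAtImInfty_of_hasSum_qExpansion one_pos hF.hasSum

lemma periodic (hF : HasQExp F φ) : Periodic (F ∘ ofComplex) (1 : ℝ) := by
  intro w
  by_cases hw : 0 < w.im
  · have hw' : 0 < (w + (1 : ℝ)).im := by simpa using hw
    simp only [comp_apply, ofComplex_apply_of_im_pos hw, ofComplex_apply_of_im_pos hw']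
    refine (hF.hasSum _).unique ?_
    convert hF.hasSum ⟨w, hw⟩ using 4
    change Periodic.qParam 1 (w + (1 : ℝ)) = Periodic.qParam 1 w
    have : 2 * π * I * (w + (1 : ℝ)) / (1 : ℝ) = 2 * π * I * w / (1 : ℝ) + 2 * π * I := by
      push_cast; ring
    rw [Periodic.qParam, this, exp_periodic, Periodic.qParam]
  · have hw' : ¬ 0 < (w + (1 : ℝ)).im := by simpa using hw
    simp only [comp_apply, ofComplex_apply_of_im_nonpos (not_lt.mp hw),
      ofComplex_apply_of_im_nonpos (not_lt.mp hw')]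

lemma eq_qExpansion (hF : HasQExp F φ) : φ = qExpansion 1 F := by
  ext m
  have ha := analyticAt_cuspFunction_zero one_pos hF.periodic hF.mdiff hF.isBoundedAtImInfty
  have h := (hasFPowerSeriesOnBall_cuspFunction one_pos ha hF.hasSum).hasFPowerSeriesAt
  simpa [qExpansion_coeff, div_eq_mul_inv, mul_comm] using
    congr_arg (FormalMultilinearSeries.coeff · m)
      (h.eq_formalMultilinearSeries ha.hasFPowerSeriesAt)

open Derivative in
lemma derivative (hF : HasQExp F φ) :
    HasQExp (normalizedDerivOfComplex F) (PowerSeries.X * PowerSeries.derivative ℂ φ) := by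
  refine ⟨normalizedDerivOfComplex_mdifferentiable hF.mdiff, fun τ ↦ ?_⟩
  set g := cuspFunction 1 F with hg
  have hdiff : DifferentiableOn ℂ g (Metric.ball 0 1) :=
    differentiableOn_cuspFunction_ball one_pos hF.periodic hF.mdiff hF.isBoundedAtImInfty
  have hq := Periodic.norm_qParam_lt_one one_pos τ.im_pos
  have hq' : Periodic.qParam 1 (τ : ℂ) ∈ Metric.ball (0 : ℂ) 1 := by simpa using hq
  have hτ : normalizedDerivOfComplex F τ =
      Periodic.qParam 1 (τ : ℂ) * deriv g (Periodic.qParam 1 (τ : ℂ)) := by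
    have heq : F ∘ ofComplex =ᶠ[𝓝 (τ : ℂ)] g ∘ Periodic.qParam 1 := by
      filter_upwards [isOpen_upperHalfPlaneSet.mem_nhds τ.im_pos] with w hw
      have := eq_cuspFunction ⟨w, hw⟩ one_ne_zero hF.periodic
      simp [ofComplex_apply_of_im_pos hw, hg, ← this]
    have hqd : HasDerivAt (Periodic.qParam 1) (2 * π * I * Periodic.qParam 1 (τ : ℂ)) (τ : ℂ) := by
      have : HasDerivAt (fun w : ℂ ↦ cexp (2 * π * I * w / (1 : ℝ)))
          (cexp (2 * π * I * τ / (1 : ℝ)) * (2 * π * I * 1 / (1 : ℝ))) (τ : ℂ) :=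
        (((hasDerivAt_id (τ : ℂ)).const_mul (2 * π * I)).div_const _).cexp
      convert! this using 1
      simp [Periodic.qParam, mul_comm]
    have hgd := (hdiff.differentiableAt (Metric.isOpen_ball.mem_nhds hq')).hasDerivAt
    rw [normalizedDerivOfComplex, heq.deriv_eq, (hgd.comp _ hqd).deriv]
    have : (2 * π * I : ℂ) ≠ 0 := two_pi_I_ne_zero
    field_simp
  have hT := Complex.hasSum_taylorSeries_on_ball (hdiff.deriv Metric.isOpen_ball) hq'
  have hcoeff (n : ℕ) : (n.factorial : ℂ)⁻¹ * iteratedDeriv n (deriv g) 0 =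
      (PowerSeries.derivative ℂ φ).coeff n := by
    rw [PowerSeries.coeff_derivative, hF.eq_qExpansion, qExpansion_coeff, ← iteratedDeriv_succ',
      Nat.factorial_succ]
    have := Nat.factorial_ne_zero n
    push_cast
    field_simp
    rfl
  rw [← hasSum_nat_add_iff' 1, hτ]
  convert! hT.mul_left (Periodic.qParam 1 (τ : ℂ)) using 1
  · ext n
    rw [PowerSeries.coeff_succ_X_mul, ← hcoeff]
    simp only [smul_eq_mul, sub_zero]
    ring
  · simp

/-- Below weight 12 a level one form is determined by its constant term. -/
lemma eq_zero_of_coeff_zero {k : ℕ} (hk : k < 12) (hF : HasQExp F φ)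
    (hslash : ∀ γ : SL(2, ℤ), F ∣[(k : ℤ)] γ = F) (h0 : φ.coeff 0 = 0) : φ = 0 := by
  let f : ModularForm 𝒮ℒ (k : ℤ) :=
    { toFun := F
      slash_action_eq' := by
        rintro _ ⟨γ, rfl⟩
        exact hslash γ
      holo' := hF.mdiff
      bdd_at_cusps' := fun {c} hc ↦ by
        rw [Subgroup.IsArithmetic.isCusp_iff_isCusp_SL2Z] at hc
        rw [OnePoint.isBoundedAt_iff_forall_SL2Z hc]
        intro γ _
        rw [hslash γ]
        exact hF.isBoundedAtImInfty }
  have hf : φ = qExpansion 1 f := hF.eq_qExpansion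
  have : f = 0 := by
    apply ModularForm.sturm_bound_levelOne_nat
    rw [← hf, Nat.div_eq_of_lt hk]
    exact pos_iff_ne_zero.mpr
      (PowerSeries.order_ne_zero_iff_constCoeff_eq_zero.mpr (by simpa using h0))
  rw [hf, this, FunLike.coe_zero, qExpansion_zero]

end HasQExp

open Derivative EisensteinSeries

/-- The `q`-series `1 + c * ∑ σ_k(n) q^n`. -/
noncomputable def eisSeries (k : ℕ) (c : ℂ) : PowerSeries ℂ :=
  .mk fun n ↦ if n = 0 then 1 else c * σ k n

lemma coeff_eisSeries (k : ℕ) (c : ℂ) (n : ℕ) :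
    (eisSeries k c).coeff n = if n = 0 then 1 else c * σ k n := PowerSeries.coeff_mk _ _

lemma hasQExp_E2 : HasQExp E2 (eisSeries 1 (-24)) :=
  ⟨E2_mdifferentiable, fun τ ↦ by
    simpa only [Periodic.qParam, ofReal_one, div_one, coeff_eisSeries] using
      hasSum_qExpansion_E2 (z := τ)⟩

lemma hasQExp_E {k : ℕ} (hk : 3 ≤ k) (hk2 : Even k) {c : ℂ}
    (hc : -(2 * k / bernoulli k : ℂ) = c) :
    HasQExp (ModularForm.E hk) (eisSeries (k - 1) c) := by
  refine ⟨(ModularForm.E hk).holo', fun τ ↦ ?_⟩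
  convert! ModularForm.hasSum_qExpansion (ModularForm.E hk) one_pos one_mem_strictPeriods_SL τ
    using 3 with m
  rw [E_qExpansion_coeff hk hk2, coeff_eisSeries, ← hc]

lemma E_slash {k : ℕ} (hk : 3 ≤ k) (γ : SL(2, ℤ)) :
    (ModularForm.E hk : ℍ → ℂ) ∣[(k : ℤ)] γ = ModularForm.E hk :=
  SlashInvariantForm.slash_action_eqn (ModularForm.E hk) _ ⟨γ, rfl⟩

lemma hasDerivAt_D2 (γ : SL(2, ℤ)) (z : ℍ) :
    HasDerivAt (D2 γ ∘ ofComplex) (-(2 * π * I) * (γ 1 0 / denom γ z) ^ 2) (z : ℂ) := by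
  have h := (hasDerivAt_denom_zpow (γ : GL (Fin 2) ℝ) (-1) z).const_mul (2 * π * I * γ 1 0 : ℂ)
  refine HasDerivAt.congr_of_eventuallyEq (f := fun w ↦ (2 * π * I * γ 1 0 : ℂ) *
    (denom γ w) ^ (-1 : ℤ)) ?_ ?_
  · convert! h using 1
    rw [show (-1 - 1 : ℤ) = -2 by norm_num, zpow_neg]
    have hz := denom_ne_zero γ z
    norm_cast
    field_simp
    simp
    ring
  · filter_upwards [isOpen_upperHalfPlaneSet.mem_nhds z.im_pos] with w hw
    simp [D2, ofComplex_apply_of_im_pos hw, div_eq_mul_inv]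

lemma mdifferentiable_D2 (γ : SL(2, ℤ)) : MDiff (D2 γ) := fun z ↦
  mdifferentiableAt_iff.mpr (hasDerivAt_D2 γ z).differentiableAt

lemma normalizedDerivOfComplex_D2 (γ : SL(2, ℤ)) (z : ℍ) :
    normalizedDerivOfComplex (D2 γ) z = -(γ 1 0 / denom γ z) ^ 2 := by
  have : (2 * π * I : ℂ) ≠ 0 := two_pi_I_ne_zero
  rw [normalizedDerivOfComplex, (hasDerivAt_D2 γ z).deriv]
  field_simp

lemma ramanujan_E2_slash (γ : SL(2, ℤ)) :
    (normalizedDerivOfComplex E2 + (-12⁻¹ : ℂ) • (E2 * E2)) ∣[((4 : ℕ) : ℤ)] γ =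
      normalizedDerivOfComplex E2 + (-12⁻¹ : ℂ) • (E2 * E2) := by
  have h4 : ((4 : ℕ) : ℤ) = 2 + 2 := rfl
  rw [h4, SlashAction.add_slash, ModularForm.SL_smul_slash, ModularForm.mul_slash_SL2]
  have h1 := normalizedDerivOfComplex_SL_slash (k := 2) E2_mdifferentiable (γ := γ)
  have h2 := E2_slash_action γ
  rw [h2, normalizedDerivOfComplex_sub _ _ E2_mdifferentiable
    ((mdifferentiable_D2 γ).const_smul _),
    normalizedDerivOfComplex_smul _ _ (mdifferentiable_D2 γ)] at h1
  ext z
  have h1 := congrFun h1 z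
  simp only [Pi.add_apply, Pi.sub_apply, Pi.smul_apply, smul_eq_mul, normalizedDerivOfComplex_D2,
    Pi.mul_apply, h2, riemannZeta_two, D2] at h1 ⊢
  set u := (γ 1 0 : ℂ) / denom γ z with hu
  have hu' : 2 * π * I * (γ 1 0 : ℂ) / denom γ z = 2 * π * I * u := by rw [hu, mul_div_assoc]
  rw [hu'] at h1 ⊢
  have hpi : (π : ℂ) ≠ 0 := by exact_mod_cast Real.pi_ne_zero
  rw [eq_comm, sub_eq_iff_eq_add] at h1
  rw [h1]
  push_cast
  field_simp
  linear_combination (24 * π * u * E2 z - 72 * I * u ^ 2) * I_sq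

lemma serreDerivative_slash {k : ℕ} (hk : 3 ≤ k) (γ : SL(2, ℤ)) :
    (normalizedDerivOfComplex (ModularForm.E hk) + (-(k * 12⁻¹) : ℂ) • (E2 * ModularForm.E hk))
      ∣[((k + 2 : ℕ) : ℤ)] γ =
    normalizedDerivOfComplex (ModularForm.E hk) + (-(k * 12⁻¹) : ℂ) • (E2 * ModularForm.E hk) := by
  have h := serreDerivative_slash_invariant (ModularForm.E hk).holo' (E_slash hk γ)
  have heq : serreDerivative (k : ℤ) (ModularForm.E hk) =
      normalizedDerivOfComplex (ModularForm.E hk) +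
        (-(k * 12⁻¹) : ℂ) • (E2 * ModularForm.E hk) := by
    ext z
    simp [sub_eq_add_neg, mul_assoc]
  exact heq ▸ h

lemma E_mul_slash {k l : ℕ} (hk : 3 ≤ k) (hl : 3 ≤ l) (γ : SL(2, ℤ)) :
    (ModularForm.E hk * ModularForm.E hl : ℍ → ℂ) ∣[((k + l : ℕ) : ℤ)] γ =
      ModularForm.E hk * ModularForm.E hl := by
  rw [Nat.cast_add, ModularForm.mul_slash_SL2, E_slash, E_slash]

lemma hasQExp_E4 : HasQExp (ModularForm.E (k := 4) (by norm_num)) (eisSeries 3 240) :=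
  hasQExp_E _ ⟨2, rfl⟩ (by norm_num [show bernoulli 4 = -1 / 30 by decide +kernel])

lemma hasQExp_E6 : HasQExp (ModularForm.E (k := 6) (by norm_num)) (eisSeries 5 (-504)) :=
  hasQExp_E _ ⟨3, rfl⟩ (by norm_num [show bernoulli 6 = 1 / 42 by decide +kernel])

lemma hasQExp_E8 : HasQExp (ModularForm.E (k := 8) (by norm_num)) (eisSeries 7 480) :=
  hasQExp_E _ ⟨4, rfl⟩ (by norm_num [show bernoulli 8 = -1 / 30 by decide +kernel])

lemma hasQExp_E10 : HasQExp (ModularForm.E (k := 10) (by norm_num)) (eisSeries 9 (-264)) :=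
  hasQExp_E _ ⟨5, rfl⟩ (by norm_num [show bernoulli 10 = 5 / 66 by decide +kernel])

lemma constantCoeff_eisSeries (k : ℕ) (c : ℂ) :
    PowerSeries.constantCoeff (eisSeries k c) = 1 := by
  simp [← PowerSeries.coeff_zero_eq_constantCoeff_apply, coeff_eisSeries]

lemma add_smul_slash {k : ℕ} {F G : ℍ → ℂ} {γ : SL(2, ℤ)} (c : ℂ) (hF : F ∣[(k : ℤ)] γ = F)
    (hG : G ∣[(k : ℤ)] γ = G) : (F + c • G) ∣[(k : ℤ)] γ = F + c • G := by
  rw [SlashAction.add_slash, ModularForm.SL_smul_slash, hF, hG]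

lemma ramanujan_eisSeries_one :
    PowerSeries.X * PowerSeries.derivative ℂ (eisSeries 1 (-24)) =
      (12⁻¹ : ℂ) • (eisSeries 1 (-24) ^ 2 - eisSeries 3 240) := by
  have h := ((hasQExp_E2.derivative.add ((hasQExp_E2.mul hasQExp_E2).smul (-12⁻¹))).add
    (hasQExp_E4.smul 12⁻¹)).eq_zero_of_coeff_zero (k := 4) (by norm_num)
    (fun γ ↦ add_smul_slash _ (ramanujan_E2_slash γ) (E_slash _ γ))
    (by simp [constantCoeff_eisSeries])
  rw [sq, ← sub_eq_zero, ← h]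
  module

lemma ramanujan_eisSeries_three :
    PowerSeries.X * PowerSeries.derivative ℂ (eisSeries 3 240) =
      (3⁻¹ : ℂ) • (eisSeries 1 (-24) * eisSeries 3 240 - eisSeries 5 (-504)) := by
  have h := ((hasQExp_E4.derivative.add ((hasQExp_E2.mul hasQExp_E4).smul (-((4 : ℕ) * 12⁻¹)))).add
    (hasQExp_E6.smul 3⁻¹)).eq_zero_of_coeff_zero (k := 6) (by norm_num)
    (fun γ ↦ add_smul_slash _ (serreDerivative_slash _ γ) (E_slash _ γ))
    (by norm_num [constantCoeff_eisSeries])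
  rw [← sub_eq_zero, ← h]
  module

lemma ramanujan_eisSeries_five :
    PowerSeries.X * PowerSeries.derivative ℂ (eisSeries 5 (-504)) =
      (2⁻¹ : ℂ) • (eisSeries 1 (-24) * eisSeries 5 (-504) - eisSeries 3 240 ^ 2) := by
  have h := ((hasQExp_E6.derivative.add ((hasQExp_E2.mul hasQExp_E6).smul (-((6 : ℕ) * 12⁻¹)))).add
    ((hasQExp_E4.mul hasQExp_E4).smul 2⁻¹)).eq_zero_of_coeff_zero (k := 8) (by norm_num)
    (fun γ ↦ add_smul_slash _ (serreDerivative_slash _ γ) (E_mul_slash _ _ γ))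
    (by norm_num [constantCoeff_eisSeries])
  rw [sq, ← sub_eq_zero, ← h]
  module

lemma eisSeries_three_sq : eisSeries 3 240 ^ 2 = eisSeries 7 480 := by
  have h := ((hasQExp_E4.mul hasQExp_E4).add (hasQExp_E8.smul (-1))).eq_zero_of_coeff_zero (k := 8)
    (by norm_num) (fun γ ↦ add_smul_slash _ (E_mul_slash _ _ γ) (E_slash _ γ))
    (by norm_num [constantCoeff_eisSeries])
  rw [sq, ← sub_eq_zero, ← h]
  module

lemma eisSeries_three_mul_five : eisSeries 3 240 * eisSeries 5 (-504) = eisSeries 9 (-264) := by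
  have h := ((hasQExp_E4.mul hasQExp_E6).add (hasQExp_E10.smul (-1))).eq_zero_of_coeff_zero
    (k := 10) (by norm_num) (fun γ ↦ add_smul_slash _ (E_mul_slash _ _ γ) (E_slash _ γ))
    (by norm_num [constantCoeff_eisSeries])
  rw [← sub_eq_zero, ← h]
  module

end Eisenstein

section Quasimodular

variable {A : Type*} [CommRing A] [Algebra ℂ A] (D : Derivation ℂ A A) {P Q R : A}

/-- If `P`, `Q`, `R` satisfy Ramanujan's differential equations, the elementary symmetric
functions of MacMahon's terms, as given by Newton's identities, are linear combinations of
derivatives of the divisor sum series `S₁, S₃, S₅, S₇, S₉`. -/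
theorem newton_sum_eq_derivations
    (hP : D P = (12⁻¹ : ℂ) • (P ^ 2 - Q)) (hQ : D Q = (3⁻¹ : ℂ) • (P * Q - R))
    (hR : D R = (2⁻¹ : ℂ) • (P * R - Q ^ 2)) {S₁ S₃ S₅ S₇ S₉ U₂ U₃ U₄ U₅ P₂ P₃ P₄ P₅ : A}
    (h₁ : S₁ = (24⁻¹ : ℂ) • (1 - P)) (h₃ : S₃ = (240⁻¹ : ℂ) • (Q - 1))
    (h₅ : S₅ = (504⁻¹ : ℂ) • (1 - R)) (h₇ : S₇ = (480⁻¹ : ℂ) • (Q ^ 2 - 1))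
    (h₉ : S₉ = (264⁻¹ : ℂ) • (1 - Q * R))
    (hP₂ : P₂ = (6⁻¹ : ℂ) • (S₃ - S₁))
    (hP₃ : P₃ = (120⁻¹ : ℂ) • (S₅ - (5 : ℂ) • S₃ + (4 : ℂ) • S₁))
    (hP₄ : P₄ = (5040⁻¹ : ℂ) • (S₇ - (14 : ℂ) • S₅ + (49 : ℂ) • S₃ - (36 : ℂ) • S₁))
    (hP₅ : P₅ = (362880⁻¹ : ℂ) •
      (S₉ - (30 : ℂ) • S₇ + (273 : ℂ) • S₅ - (820 : ℂ) • S₃ + (576 : ℂ) • S₁))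
    (hU₂ : U₂ = (2⁻¹ : ℂ) • (S₁ * S₁ - P₂))
    (hU₃ : U₃ = (3⁻¹ : ℂ) • (U₂ * S₁ - S₁ * P₂ + P₃))
    (hU₄ : U₄ = (4⁻¹ : ℂ) • (U₃ * S₁ - U₂ * P₂ + S₁ * P₃ - P₄))
    (hU₅ : U₅ = (5⁻¹ : ℂ) • (U₄ * S₁ - U₃ * P₂ + U₂ * P₃ - S₁ * P₄ + P₅)) :
    (8 : ℂ) • U₂ = S₁ - (2 : ℂ) • D S₁ + S₃ ∧
    (1920 : ℂ) • U₃ = (37 : ℂ) • S₁ - (100 : ℂ) • D S₁ + (40 : ℂ) • D (D S₁) + (50 : ℂ) • S₃ -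
      (30 : ℂ) • D S₃ + (3 : ℂ) • S₅ ∧
    (967680 : ℂ) • U₄ = (3229 : ℂ) • S₁ - (9870 : ℂ) • D S₁ + (5880 : ℂ) • D (D S₁) -
      (840 : ℂ) • D (D (D S₁)) + (4935 : ℂ) • S₃ - (4410 : ℂ) • D S₃ + (756 : ℂ) • D (D S₃) +
      (441 : ℂ) • S₅ - (126 : ℂ) • D S₅ + (5 : ℂ) • S₇ ∧
    (154828800 : ℂ) • U₅ = (96111 : ℂ) • S₁ - (314200 : ℂ) • D S₁ + (223440 : ℂ) • D (D S₁) -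
      (50400 : ℂ) • D (D (D S₁)) + (3360 : ℂ) • D (D (D (D S₁))) + (157100 : ℂ) • S₃ -
      (167580 : ℂ) • D S₃ + (45360 : ℂ) • D (D S₃) - (3360 : ℂ) • D (D (D S₃)) + (16758 : ℂ) • S₅
      - (7560 : ℂ) • D S₅ + (720 : ℂ) • D (D S₅) + (300 : ℂ) • S₇ - (50 : ℂ) • D S₇ + S₉ := by
  subst hU₅ hU₄ hU₃ hU₂ hP₅ hP₄ hP₃ hP₂ h₁ h₃ h₅ h₇ h₉
  simp only [D.map_smul, map_sub, map_add, map_zero, D.map_one_eq_zero, D.leibniz, D.leibniz_pow,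
    map_nsmul, hP, hQ, hR, smul_eq_mul, Nat.add_one_sub_one, pow_one]
  exact ⟨by algebra, by algebra, by algebra, by algebra⟩

end Quasimodular

section MacMahon

open PowerSeries
/-- The power series `∑ m X^m = X / (1 - X)^2`. -/
noncomputable def natSeries : ℂ⟦X⟧ := .mk fun m ↦ (m : ℂ)

lemma natSeries_eq : natSeries = X * (mk 1 : ℂ⟦X⟧) ^ 2 := by
  ext n
  rw [natSeries, mk_one_pow_eq_mk_choose_add]
  cases n <;> simp [coeff_succ_X_mul, add_comm]

lemma coeff_natSeries_pow (i m : ℕ) :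
    (natSeries ^ (i + 1)).coeff m = ((m + i).choose (2 * i + 1) : ℂ) := by
  rw [natSeries_eq, mul_pow, ← pow_mul, show 2 * (i + 1) = 2 * i + 1 + 1 by ring,
    mk_one_pow_eq_mk_choose_add, coeff_X_pow_mul']
  split_ifs with h
  · rw [coeff_mk]
    congr 2
    omega
  · rw [Nat.choose_eq_zero_of_lt (by omega), Nat.cast_zero]

/-- The power series `∑ k, (X^k / (1 - X^k)^2)^i`. -/
noncomputable def macMahonPsum (i : ℕ) : ℂ⟦X⟧ :=
  .mk fun m ↦ ∑ d ∈ m.divisors, (natSeries ^ i).coeff d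

/-- The generating series `∑ σ_k(m) X^m` of the divisor sums. -/
noncomputable def sigmaSeries (k : ℕ) : ℂ⟦X⟧ := .mk fun m ↦ (ArithmeticFunction.sigma k m : ℂ)

lemma coeff_sigmaSeries (k m : ℕ) : (sigmaSeries k).coeff m = ∑ d ∈ m.divisors, (d : ℂ) ^ k := by
  simp [sigmaSeries, ArithmeticFunction.sigma_apply]

lemma cast_choose_eq (m k : ℕ) :
    (m.choose k : ℂ) = (k.factorial : ℂ)⁻¹ * (descPochhammer ℂ k).eval (m : ℂ) := by
  rw [descPochhammer_eval_eq_descFactorial, Nat.descFactorial_eq_factorial_mul_choose]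
  have := Nat.factorial_ne_zero k
  push_cast
  field_simp

lemma macMahonPsum_one : macMahonPsum 1 = sigmaSeries 1 := by
  ext m
  simp [macMahonPsum, coeff_sigmaSeries, natSeries]

lemma macMahonPsum_two : macMahonPsum 2 = (6⁻¹ : ℂ) • (sigmaSeries 3 - sigmaSeries 1) := by
  ext m
  simp only [macMahonPsum, coeff_mk, coeff_natSeries_pow, coeff_sigmaSeries, coeff_smul, map_sub,
    smul_eq_mul, mul_sum, ← sum_sub_distrib, cast_choose_eq,
    Nat.factorial, descPochhammer_succ_eval, descPochhammer_zero, Polynomial.eval_one]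
  refine sum_congr rfl fun d _ ↦ ?_
  push_cast
  ring

lemma macMahonPsum_three : macMahonPsum 3 =
    (120⁻¹ : ℂ) • (sigmaSeries 5 - (5 : ℂ) • sigmaSeries 3 + (4 : ℂ) • sigmaSeries 1) := by
  ext m
  simp only [macMahonPsum, coeff_mk, coeff_natSeries_pow, coeff_sigmaSeries, coeff_smul, map_sub,
    map_add, smul_eq_mul, mul_sum, ← sum_sub_distrib, ← sum_add_distrib, cast_choose_eq,
    Nat.factorial, descPochhammer_succ_eval, descPochhammer_zero, Polynomial.eval_one]
  refine sum_congr rfl fun d _ ↦ ?_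
  push_cast
  ring

lemma macMahonPsum_four : macMahonPsum 4 = (5040⁻¹ : ℂ) • (sigmaSeries 7 -
    (14 : ℂ) • sigmaSeries 5 + (49 : ℂ) • sigmaSeries 3 - (36 : ℂ) • sigmaSeries 1) := by
  ext m
  simp only [macMahonPsum, coeff_mk, coeff_natSeries_pow, coeff_sigmaSeries, coeff_smul, map_sub,
    map_add, smul_eq_mul, mul_sum, ← sum_sub_distrib, ← sum_add_distrib, cast_choose_eq,
    Nat.factorial, descPochhammer_succ_eval, descPochhammer_zero, Polynomial.eval_one]
  refine sum_congr rfl fun d _ ↦ ?_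
  push_cast
  ring

lemma macMahonPsum_five : macMahonPsum 5 = (362880⁻¹ : ℂ) • (sigmaSeries 9 -
    (30 : ℂ) • sigmaSeries 7 + (273 : ℂ) • sigmaSeries 5 - (820 : ℂ) • sigmaSeries 3 +
      (576 : ℂ) • sigmaSeries 1) := by
  ext m
  simp only [macMahonPsum, coeff_mk, coeff_natSeries_pow, coeff_sigmaSeries, coeff_smul, map_sub,
    map_add, smul_eq_mul, mul_sum, ← sum_sub_distrib, ← sum_add_distrib, cast_choose_eq,
    Nat.factorial, descPochhammer_succ_eval, descPochhammer_zero, Polynomial.eval_one]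
  refine sum_congr rfl fun d _ ↦ ?_
  push_cast
  ring

/-- The quotient map `ℂ⟦X⟧ → ℂ⟦X⟧ / (X^n)`. -/
noncomputable abbrev modXPow (n : ℕ) : ℂ⟦X⟧ →ₐ[ℂ] ℂ⟦X⟧ ⧸ Ideal.span {(X : ℂ⟦X⟧) ^ n} :=
  Ideal.Quotient.mkₐ ℂ _

lemma modXPow_eq_iff {n : ℕ} {φ ψ : ℂ⟦X⟧} :
    modXPow n φ = modXPow n ψ ↔ ∀ m < n, φ.coeff m = ψ.coeff m := by
  simp [Ideal.Quotient.eq, Ideal.mem_span_singleton, X_pow_dvd_iff, sub_eq_zero]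

/-- The series `X^k / (1 - X^k)^2` with the terms beyond `s = n` removed. -/
noncomputable def truncTerm (n : ℕ) (k : Fin (n + 1)) : ℂ⟦X⟧ :=
  ∑ s : Fin (n + 1), if k = 0 then 0 else monomial ((s : ℕ) * (k : ℕ)) ((s : ℕ) : ℂ)

lemma modXPow_truncTerm (n : ℕ) (k : Fin (n + 1)) (hk : (k : ℕ) ≠ 0) :
    modXPow (n + 1) (truncTerm n k) = modXPow (n + 1) (expand k hk natSeries) := by
  rw [modXPow_eq_iff]
  intro m hm
  have hk' : k ≠ 0 := fun h ↦ hk (by simp [h])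
  have hpos := Nat.pos_of_ne_zero hk
  simp only [truncTerm, hk', if_false, map_sum, coeff_monomial, coeff_expand, natSeries, coeff_mk]
  split_ifs with h
  · obtain ⟨c, rfl⟩ := h
    have hc : c < n + 1 := (Nat.le_mul_of_pos_left _ hpos).trans_lt hm
    rw [Finset.sum_eq_single ⟨c, hc⟩, if_pos (mul_comm _ _), Nat.mul_div_cancel_left _ hpos]
    · intro b _ hb
      refine if_neg fun h ↦ hb ?_
      rw [mul_comm] at h
      exact Fin.ext (Nat.eq_of_mul_eq_mul_right hpos h).symm
    · simp
  · refine Finset.sum_eq_zero fun s _ ↦ if_neg ?_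
    rintro rfl
    exact h ⟨s, mul_comm _ _⟩

lemma modXPow_sum_truncTerm_pow (n : ℕ) {i : ℕ} (hi : i ≠ 0) :
    modXPow (n + 1) (∑ k, truncTerm n k ^ i) = modXPow (n + 1) (macMahonPsum i) := by
  have hpow : modXPow (n + 1) (∑ k, truncTerm n k ^ i) = modXPow (n + 1)
      (∑ k : Fin (n + 1), if hk : (k : ℕ) ≠ 0 then expand k hk (natSeries ^ i) else 0) := by
    rw [map_sum, map_sum]
    refine sum_congr rfl fun k _ ↦ ?_
    split_ifs with hk
    · rw [map_pow, modXPow_truncTerm n k hk, ← map_pow, ← map_pow]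
    · have : k = 0 := Fin.val_eq_zero_iff.mp (not_not.mp hk)
      simp only [truncTerm, this, if_true, sum_const_zero, zero_pow hi]
  rw [hpow, modXPow_eq_iff]
  intro m hm
  have hcoeff (k : Fin (n + 1)) :
      (if hk : (k : ℕ) ≠ 0 then expand k hk (natSeries ^ i) else 0).coeff m =
        (fun k : ℕ ↦ if k ≠ 0 ∧ k ∣ m then (natSeries ^ i).coeff (m / k) else 0) k := by
    by_cases hk : (k : ℕ) ≠ 0
    · rw [dif_pos hk, coeff_expand]
      simp only [hk, ne_eq, not_false_eq_true, true_and]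
    · simp [hk]
  rw [map_sum, sum_congr rfl fun k _ ↦ hcoeff k, Fin.sum_univ_eq_sum_range
    (fun k : ℕ ↦ if k ≠ 0 ∧ k ∣ m then (natSeries ^ i).coeff (m / k) else 0),
    macMahonPsum, coeff_mk]
  rcases eq_or_ne m 0 with rfl | hm0
  · simp [natSeries, hi]
  rw [← Nat.sum_div_divisors, ← sum_filter]
  refine sum_congr ?_ fun _ _ ↦ rfl
  ext k
  simp only [mem_filter, mem_range, Nat.mem_divisors]
  constructor
  · exact fun h ↦ ⟨h.2.2, hm0⟩
  · exact fun h ↦ ⟨(Nat.le_of_dvd (Nat.pos_of_ne_zero hm0) h.1).trans_lt hm,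
      ne_zero_of_dvd_ne_zero hm0 h.1, h.1⟩

/-- The elementary symmetric polynomials are sums over strictly increasing tuples. -/
lemma sum_strictMono_prod {R : Type*} [CommRing R] {a n : ℕ} (y : Fin n → R) :
    ∑ g : Fin a → Fin n with StrictMono g, ∏ i, y (g i) =
      MvPolynomial.eval y (MvPolynomial.esymm (Fin n) R a) := by
  simp only [MvPolynomial.esymm, map_sum, map_prod, MvPolynomial.eval_X]
  refine sum_bij (fun g _ ↦ univ.image g) ?_ ?_ ?_ ?_
  · intro g hg
    rw [mem_powersetCard_univ, card_image_of_injective _ (mem_filter.mp hg).2.injective, card_fin]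
  · intro g hg g' hg' h
    refine ((mem_filter.mp hg).2.range_inj (mem_filter.mp hg').2).mp ?_
    simpa using congrArg (fun s : Finset (Fin n) ↦ (s : Set (Fin n))) h
  · intro t ht
    rw [mem_powersetCard_univ] at ht
    refine ⟨t.orderEmbOfFin ht, by simp [(t.orderEmbOfFin ht).strictMono], ?_⟩
    exact_mod_cast
      (by simp : ((univ.image (t.orderEmbOfFin ht) : Finset (Fin n)) : Set (Fin n)) = t)
  · intro g hg
    rw [prod_image (mem_filter.mp hg).2.injective.injOn]

lemma cast_MO_eq_coeff (a n : ℕ) : (MO a n : ℂ) =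
    (MvPolynomial.eval (truncTerm n) (MvPolynomial.esymm (Fin (n + 1)) ℂ⟦X⟧ a)).coeff n := by
  rw [← sum_strictMono_prod]
  simp only [truncTerm, prod_univ_sum, Fintype.piFinset_univ, map_sum]
  rw [← sum_product', MO, Nat.cast_sum]
  trans ∑ f : Fin a → Fin (n + 1) × Fin (n + 1) with StrictMono fun i ↦ (f i).1,
    coeff n (∏ i, if (f i).1 = 0 then 0 else
      monomial (((f i).2 : ℕ) * ((f i).1 : ℕ)) (((f i).2 : ℕ) : ℂ))
  · rw [sum_filter, sum_filter]
    refine sum_congr rfl fun f _ ↦ ?_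
    by_cases hmono : StrictMono fun i ↦ (f i).1
    · have hmono' : ∀ i j, i < j → (f i).1 < (f j).1 := fun i j h ↦ hmono h
      rw [if_pos hmono]
      by_cases hk : ∃ i, (f i).1 = 0
      · obtain ⟨i, hi⟩ := hk
        have h0 : ∏ i, (if (f i).1 = 0 then 0 else
            monomial (((f i).2 : ℕ) * ((f i).1 : ℕ)) (((f i).2 : ℕ) : ℂ)) = 0 :=
          prod_eq_zero (mem_univ i) (if_pos hi)
        rw [h0, map_zero, if_neg]
        intro h
        simpa [hi] using (h.1 i).1
      · push Not at hk
        rw [prod_congr rfl fun i _ ↦ if_neg (hk i), prod_monomial, coeff_monomial]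
        by_cases hs : ∃ i, (f i).2 = 0
        · obtain ⟨i, hi⟩ := hs
          rw [if_neg, prod_eq_zero (mem_univ i) (by simp [hi]), ite_self]
          intro h
          simpa [hi] using (h.1 i).2
        · push Not at hs
          have hpos : ∀ i, 0 < ((f i).1 : ℕ) ∧ 0 < ((f i).2 : ℕ) := fun i ↦
            ⟨Fin.pos_iff_ne_zero.mpr (hk i), Fin.pos_iff_ne_zero.mpr (hs i)⟩
          simp only [hpos, eq_true hmono', Nat.cast_prod, eq_comm (a := n), true_and, implies_true]
    · rw [if_neg hmono, if_neg]
      exact fun h ↦ hmono fun i j hij ↦ h.2.1 i j hij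
  · refine sum_nbij' (fun f ↦ (fun i ↦ (f i).1, fun i ↦ (f i).2))
      (fun x i ↦ (x.1 i, x.2 i)) ?_ ?_ ?_ ?_ ?_ <;> simp

/-- Newton's identities in low degree. -/
lemma newton_explicit {B : Type*} [CommRing B] [Algebra ℂ B] {e p : ℕ → B} (h0 : e 0 = 1)
    (h : ∀ k ≠ 0, e k = (k : ℂ)⁻¹ • ((-1) ^ (k + 1) *
      ∑ a ∈ antidiagonal k with a.1 < k, (-1) ^ a.1 * e a.1 * p a.2)) :
    e 1 = p 1 ∧ e 2 = (2⁻¹ : ℂ) • (p 1 * p 1 - p 2) ∧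
    e 3 = (3⁻¹ : ℂ) • (e 2 * p 1 - p 1 * p 2 + p 3) ∧
    e 4 = (4⁻¹ : ℂ) • (e 3 * p 1 - e 2 * p 2 + p 1 * p 3 - p 4) ∧
    e 5 = (5⁻¹ : ℂ) • (e 4 * p 1 - e 3 * p 2 + e 2 * p 3 - p 1 * p 4 + p 5) := by
  have h1 := h 1 (by norm_num)
  have h2 := h 2 (by norm_num)
  have h3 := h 3 (by norm_num)
  have h4 := h 4 (by norm_num)
  have h5 := h 5 (by norm_num)
  simp only [sum_filter, Nat.sum_antidiagonal_eq_sum_range_succ_mk, sum_range_succ, range_zero,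
    sum_empty, h0] at h1 h2 h3 h4 h5
  norm_num at h1 h2 h3 h4 h5
  rw [h1] at h2 h3 h4 h5
  refine ⟨h1, h2.trans ?_, h3.trans ?_, h4.trans ?_, h5.trans ?_⟩ <;> algebra

lemma MO_newton (n : ℕ) {U₂ U₃ U₄ U₅ : ℂ⟦X⟧}
    (hU₂ : U₂ = (2⁻¹ : ℂ) • (macMahonPsum 1 * macMahonPsum 1 - macMahonPsum 2))
    (hU₃ : U₃ = (3⁻¹ : ℂ) •
      (U₂ * macMahonPsum 1 - macMahonPsum 1 * macMahonPsum 2 + macMahonPsum 3))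
    (hU₄ : U₄ = (4⁻¹ : ℂ) • (U₃ * macMahonPsum 1 - U₂ * macMahonPsum 2 +
      macMahonPsum 1 * macMahonPsum 3 - macMahonPsum 4))
    (hU₅ : U₅ = (5⁻¹ : ℂ) • (U₄ * macMahonPsum 1 - U₃ * macMahonPsum 2 + U₂ * macMahonPsum 3 -
      macMahonPsum 1 * macMahonPsum 4 + macMahonPsum 5)) :
    (MO 2 n : ℂ) = U₂.coeff n ∧ (MO 3 n : ℂ) = U₃.coeff n ∧ (MO 4 n : ℂ) = U₄.coeff n ∧
      (MO 5 n : ℂ) = U₅.coeff n := by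
  let ψ : MvPolynomial (Fin (n + 1)) ℂ⟦X⟧ →+* ℂ⟦X⟧ ⧸ Ideal.span {(X : ℂ⟦X⟧) ^ (n + 1)} :=
    (modXPow (n + 1) : ℂ⟦X⟧ →+* _).comp (MvPolynomial.eval (truncTerm n))
  obtain ⟨e, he⟩ : ∃ e, e = fun k ↦ ψ (MvPolynomial.esymm (Fin (n + 1)) ℂ⟦X⟧ k) := ⟨_, rfl⟩
  obtain ⟨p, hp⟩ : ∃ p, p = fun k ↦ modXPow (n + 1) (macMahonPsum k) := ⟨_, rfl⟩
  have hpsum (k : ℕ) (hk : k ≠ 0) : ψ (MvPolynomial.psum (Fin (n + 1)) ℂ⟦X⟧ k) = p k := by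
    simp only [hp]
    rw [← modXPow_sum_truncTerm_pow n hk]
    simp [ψ, MvPolynomial.psum]
  have hnewton (k : ℕ) (hk : k ≠ 0) : e k = (k : ℂ)⁻¹ • ((-1) ^ (k + 1) *
      ∑ a ∈ antidiagonal k with a.1 < k, (-1) ^ a.1 * e a.1 * p a.2) := by
    have h := congrArg ψ (MvPolynomial.mul_esymm_eq_sum (Fin (n + 1)) ℂ⟦X⟧ k)
    simp only [map_mul, map_natCast, map_pow, map_neg, map_one, map_sum] at h
    rw [sum_congr rfl fun a ha ↦ by
      rw [← hpsum a.2 (by have := mem_antidiagonal.mp (mem_filter.mp ha).1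
                          have := (mem_filter.mp ha).2
                          omega)]]
    rw [he, ← h, ← nsmul_eq_mul, ← Nat.cast_smul_eq_nsmul ℂ,
      inv_smul_smul₀ (Nat.cast_ne_zero.mpr hk)]
  have hcoeff {a : ℕ} {U : ℂ⟦X⟧} (h : e a = modXPow (n + 1) U) : (MO a n : ℂ) = U.coeff n := by
    rw [cast_MO_eq_coeff]
    rw [he] at h
    exact modXPow_eq_iff.mp h n n.lt_succ_self
  have h0 : e 0 = 1 := by simp [he]
  obtain ⟨h1, h2, h3, h4, h5⟩ := newton_explicit h0 hnewton
  have e2 : e 2 = modXPow (n + 1) U₂ := by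
    simp only [hU₂, h2, hp, map_smul, map_sub, map_mul]
  have e3 : e 3 = modXPow (n + 1) U₃ := by
    simp only [hU₃, h3, e2, hp, map_smul, map_sub, map_add, map_mul]
  have e4 : e 4 = modXPow (n + 1) U₄ := by
    simp only [hU₄, h4, e3, e2, hp, map_smul, map_sub, map_add, map_mul]
  have e5 : e 5 = modXPow (n + 1) U₅ := by
    simp only [hU₅, h5, e4, e3, e2, hp, map_smul, map_sub, map_add, map_mul]
  exact ⟨hcoeff e2, hcoeff e3, hcoeff e4, hcoeff e5⟩

open scoped ArithmeticFunction.sigma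

/-- The Euler operator `X * d/dX` on power series. -/
noncomputable def eulerDerivation : Derivation ℂ ℂ⟦X⟧ ℂ⟦X⟧ := (X : ℂ⟦X⟧) • derivative ℂ

lemma eulerDerivation_apply (φ : ℂ⟦X⟧) : eulerDerivation φ = X * derivative ℂ φ := rfl

lemma coeff_eulerDerivation (φ : ℂ⟦X⟧) (n : ℕ) :
    (eulerDerivation φ).coeff n = n * φ.coeff n := by
  rw [eulerDerivation_apply]
  cases n with
  | zero => simp
  | succ n => simp [coeff_succ_X_mul, coeff_derivative, mul_comm]

lemma sigmaSeries_eq (k : ℕ) {c : ℂ} (hc : c ≠ 0) :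
    sigmaSeries k = c⁻¹ • (eisSeries k c - 1) := by
  ext n
  rw [coeff_smul, map_sub, coeff_eisSeries, coeff_one, sigmaSeries, coeff_mk]
  split_ifs with h
  · simp [h]
  · simp [hc]

/-- MacMahon's series as linear combinations of derivatives of Eisenstein series. -/
lemma MO_eq_sigma (n : ℕ) :
    (8 * MO 2 n : ℤ) = (1 - 2 * n) * σ 1 n + σ 3 n ∧
    (1920 * MO 3 n : ℤ) =
      (37 - 100 * n + 40 * n ^ 2) * σ 1 n + (50 - 30 * n) * σ 3 n + 3 * σ 5 n ∧
    (967680 * MO 4 n : ℤ) = (3229 - 9870 * n + 5880 * n ^ 2 - 840 * n ^ 3) * σ 1 n +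
      (4935 - 4410 * n + 756 * n ^ 2) * σ 3 n + (441 - 126 * n) * σ 5 n + 5 * σ 7 n ∧
    (154828800 * MO 5 n : ℤ) =
      (96111 - 314200 * n + 223440 * n ^ 2 - 50400 * n ^ 3 + 3360 * n ^ 4) * σ 1 n +
      (157100 - 167580 * n + 45360 * n ^ 2 - 3360 * n ^ 3) * σ 3 n +
      (16758 - 7560 * n + 720 * n ^ 2) * σ 5 n + (300 - 50 * n) * σ 7 n + σ 9 n := by
  obtain ⟨h₂, h₃, h₄, h₅⟩ := MO_newton n rfl rfl rfl rfl
  rw [macMahonPsum_one] at h₂ h₃ h₄ h₅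
  have key := newton_sum_eq_derivations eulerDerivation
    ramanujan_eisSeries_one ramanujan_eisSeries_three ramanujan_eisSeries_five
    (S₁ := sigmaSeries 1) (S₃ := sigmaSeries 3) (S₅ := sigmaSeries 5) (S₇ := sigmaSeries 7)
    (S₉ := sigmaSeries 9)
    (by rw [sigmaSeries_eq 1 (c := -24) (by norm_num), inv_neg, neg_smul, ← smul_neg, neg_sub])
    (sigmaSeries_eq 3 (c := 240) (by norm_num))
    (by rw [sigmaSeries_eq 5 (c := -504) (by norm_num), inv_neg, neg_smul, ← smul_neg, neg_sub])
    (by rw [eisSeries_three_sq, sigmaSeries_eq 7 (c := 480) (by norm_num)])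
    (by rw [eisSeries_three_mul_five, sigmaSeries_eq 9 (c := -264) (by norm_num), inv_neg,
      neg_smul, ← smul_neg, neg_sub])
    macMahonPsum_two macMahonPsum_three macMahonPsum_four macMahonPsum_five rfl rfl rfl rfl
  obtain ⟨k₂, k₃, k₄, k₅⟩ := key
  replace k₂ := congrArg (coeff n) k₂
  replace k₃ := congrArg (coeff n) k₃
  replace k₄ := congrArg (coeff n) k₄
  replace k₅ := congrArg (coeff n) k₅
  rw [coeff_smul, ← h₂] at k₂
  rw [coeff_smul, ← h₃] at k₃
  rw [coeff_smul, ← h₄] at k₄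
  rw [coeff_smul, ← h₅] at k₅
  simp only [map_add, map_sub, coeff_smul, coeff_eulerDerivation, smul_eq_mul, sigmaSeries,
    coeff_mk] at k₂ k₃ k₄ k₅
  refine ⟨?_, ?_, ?_, ?_⟩ <;> apply Int.cast_injective (α := ℂ) <;> push_cast
  · linear_combination k₂
  · linear_combination k₃
  · linear_combination k₄
  · linear_combination k₅

lemma sigma_prime_mul_eq_zero {ℓ p n k : ℕ} (hp : p.Prime) (hpc : (p : ZMod ℓ) = -1)
    (hpn : ¬ p ∣ n) (hk : Odd k) : (σ k (p * n) : ZMod ℓ) = 0 := by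
  rw [ArithmeticFunction.isMultiplicative_sigma.map_mul_of_coprime
    (hp.coprime_iff_not_dvd.mpr hpn), ← pow_one p, ArithmeticFunction.sigma_apply_prime_pow hp]
  simp [sum_range_succ, hpc, hk.neg_one_pow]

end MacMahon

/-- let `a ∈ {2,3,4,5}`, let `ℓ ≥ 11` be prime, and let `p` be a prime
with `p ≡ -1 (mod ℓ)`. Then for every positive integer `n` not divisible by `p`,
`MO (a; pn) ≡ 0 (mod ℓ)`. -/
theorem MO_p_congruence_large_ell (a : ℕ) (ha : a ∈ ({2, 3, 4, 5} : Finset ℕ))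
    (ℓ : ℕ) (hℓ : ℓ.Prime) (hℓ' : 11 ≤ ℓ)
    (p : ℕ) (hp : p.Prime) (hpc : (p : ℤ) ≡ -1 [ZMOD (ℓ : ℤ)])
    (n : ℕ) (hn : 0 < n) (hpn : ¬ p ∣ n) :
    ℓ ∣ MO a (p * n) := by
  have := Fact.mk hℓ
  have hpc' : (p : ZMod ℓ) = -1 := by
    simpa using (ZMod.intCast_eq_intCast_iff _ _ _).mpr hpc
  have hσ {k : ℕ} (hk : Odd k) := sigma_prime_mul_eq_zero (ℓ := ℓ) hp hpc' hpn hk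
  have hσ₁ := hσ (k := 1) (by decide)
  have hσ₃ := hσ (k := 3) (by decide)
  have hσ₅ := hσ (k := 5) (by decide)
  have hσ₇ := hσ (k := 7) (by decide)
  have hσ₉ := hσ (k := 9) (by decide)
  have hcancel {K : ℕ} (hK : K ∣ Nat.factorial 7 ^ 4) (h : (K : ZMod ℓ) * MO a (p * n) = 0) :
      ℓ ∣ MO a (p * n) := by
    rw [← Nat.cast_mul, ZMod.natCast_eq_zero_iff, hℓ.dvd_mul] at h
    refine h.resolve_left fun h' ↦ ?_
    have := hℓ.dvd_factorial.mp (hℓ.dvd_of_dvd_pow (h'.trans hK))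
    omega
  obtain ⟨h₂, h₃, h₄, h₅⟩ := MO_eq_sigma (p * n)
  simp only [mem_insert, mem_singleton] at ha
  rcases ha with rfl | rfl | rfl | rfl
  · apply hcancel (K := 8) (by decide)
    simpa [hσ₁, hσ₃] using congrArg (Int.cast : ℤ → ZMod ℓ) h₂
  · apply hcancel (K := 1920) (by decide)
    simpa [hσ₁, hσ₃, hσ₅] using congrArg (Int.cast : ℤ → ZMod ℓ) h₃
  · apply hcancel (K := 967680) (by decide)
    simpa [hσ₁, hσ₃, hσ₅, hσ₇] using congrArg (Int.cast : ℤ → ZMod ℓ) h₄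
  · apply hcancel (K := 154828800) (by decide)
    simpa [hσ₁, hσ₃, hσ₅, hσ₇, hσ₉] using congrArg (Int.cast : ℤ → ZMod ℓ) h₅
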